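/- Let G = (N, Σ, P, s) be a generative grammar all of whose productions have non-empty left- and right-hand sides, and let a1, …, an ∈ Σ. If the sequent Φ_G, Γ_G, a1, …, an → s is derivable in !L1, then the sequent Γ_G, a1, …, an → s is derivable in !wL1. -/

import Mathlib

namespace Lambek

/-! ## Formulae of `!bL1` (Lambek calculus with unit, brackets and subexponential) -/

/-- Formulae: primitive types, the unit `1`, `\`, `/`, `·`, `⟨⟩`, `[]⁻¹`, `!`. -/
inductive Fm : Type
  | var : ℕ → Fm
  | one : Fm
  | ldiv : Fm → Fm → Fm   -- `ldiv A C` is `A \ C`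
  | rdiv : Fm → Fm → Fm   -- `rdiv C B` is `C / B`
  | mul : Fm → Fm → Fm    -- `A · B`
  | dia : Fm → Fm         -- `⟨⟩ A`
  | binv : Fm → Fm        -- `[]⁻¹ A`
  | bang : Fm → Fm        -- `! A`

/-- Items of a meta-formula: a formula or a bracketed meta-formula. -/
inductive Item : Type
  | fm : Fm → Item
  | br : List Item → Item

/-- Meta-formulae (configurations): finite ordered sequences of items. -/
abbrev Meta := List Item

/-- `!A₁, …, !Aₙ` as a meta-formula. -/
def bangs (Φ : List Fm) : Meta := Φ.map (fun F => Item.fm (Fm.bang F))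

/-- A meta-formula with a designated (hole) occurrence of a meta-formula,
possibly under nested brackets. -/
inductive Ctx : Type
  | hole : Meta → Meta → Ctx
  | br : Meta → Ctx → Meta → Ctx

/-- Plug a meta-formula into the designated occurrence. -/
def Ctx.fill : Ctx → Meta → Meta
  | Ctx.hole Δ₁ Δ₂, Γ => Δ₁ ++ Γ ++ Δ₂
  | Ctx.br Δ₁ c Δ₂, Γ => Δ₁ ++ (Item.br (c.fill Γ)) :: Δ₂

/-- Derivability in `!bL1`.  The boolean parameter says whether the rule (cut)
is allowed: `DervB true` is full `!bL1`, `DervB false` is cut-free derivability. -/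
inductive DervB : Bool → Meta → Fm → Prop
  | id (cf : Bool) (A : Fm) : DervB cf [Item.fm A] A
  | one_r (cf : Bool) : DervB cf [] Fm.one
  | rdiv_l (cf : Bool) (Δ : Ctx) (Γ : Meta) (B C D : Fm) :
      DervB cf Γ B → DervB cf (Δ.fill [Item.fm C]) D →
      DervB cf (Δ.fill (Item.fm (Fm.rdiv C B) :: Γ)) D
  | rdiv_r (cf : Bool) (Γ : Meta) (B C : Fm) :
      DervB cf (Γ ++ [Item.fm B]) C → DervB cf Γ (Fm.rdiv C B)
  | ldiv_l (cf : Bool) (Δ : Ctx) (Γ : Meta) (A C D : Fm) :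
      DervB cf Γ A → DervB cf (Δ.fill [Item.fm C]) D →
      DervB cf (Δ.fill (Γ ++ [Item.fm (Fm.ldiv A C)])) D
  | ldiv_r (cf : Bool) (Γ : Meta) (A C : Fm) :
      DervB cf (Item.fm A :: Γ) C → DervB cf Γ (Fm.ldiv A C)
  | mul_l (cf : Bool) (Δ : Ctx) (A B D : Fm) :
      DervB cf (Δ.fill [Item.fm A, Item.fm B]) D →
      DervB cf (Δ.fill [Item.fm (Fm.mul A B)]) D
  | mul_r (cf : Bool) (Γ₁ Γ₂ : Meta) (A B : Fm) :
      DervB cf Γ₁ A → DervB cf Γ₂ B → DervB cf (Γ₁ ++ Γ₂) (Fm.mul A B)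
  | one_l (cf : Bool) (Δ : Ctx) (A : Fm) :
      DervB cf (Δ.fill []) A → DervB cf (Δ.fill [Item.fm Fm.one]) A
  | dia_l (cf : Bool) (Δ : Ctx) (A C : Fm) :
      DervB cf (Δ.fill [Item.br [Item.fm A]]) C →
      DervB cf (Δ.fill [Item.fm (Fm.dia A)]) C
  | dia_r (cf : Bool) (Θ : Meta) (A : Fm) :
      DervB cf Θ A → DervB cf [Item.br Θ] (Fm.dia A)
  | binv_l (cf : Bool) (Δ : Ctx) (A C : Fm) :
      DervB cf (Δ.fill [Item.fm A]) C →
      DervB cf (Δ.fill [Item.br [Item.fm (Fm.binv A)]]) C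
  | binv_r (cf : Bool) (Θ : Meta) (A : Fm) :
      DervB cf [Item.br Θ] A → DervB cf Θ (Fm.binv A)
  | bang_l (cf : Bool) (Δ : Ctx) (A B : Fm) :
      DervB cf (Δ.fill [Item.fm A]) B → DervB cf (Δ.fill [Item.fm (Fm.bang A)]) B
  | bang_r (cf : Bool) (Φ : List Fm) (A : Fm) :
      DervB cf (bangs Φ) A → DervB cf (bangs Φ) (Fm.bang A)
  | contr (cf : Bool) (Δ : Ctx) (Φ : List Fm) (Γ : Meta) (B : Fm) :
      Φ ≠ [] →
      DervB cf (Δ.fill (bangs Φ ++ [Item.br (bangs Φ ++ Γ)])) B →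
      DervB cf (Δ.fill (bangs Φ ++ Γ)) B
  | perm1 (cf : Bool) (Δ : Ctx) (A : Fm) (Γ : Meta) (B : Fm) :
      DervB cf (Δ.fill (Item.fm (Fm.bang A) :: Γ)) B →
      DervB cf (Δ.fill (Γ ++ [Item.fm (Fm.bang A)])) B
  | perm2 (cf : Bool) (Δ : Ctx) (A : Fm) (Γ : Meta) (B : Fm) :
      DervB cf (Δ.fill (Γ ++ [Item.fm (Fm.bang A)])) B →
      DervB cf (Δ.fill (Item.fm (Fm.bang A) :: Γ)) B
  | cut (Δ : Ctx) (Θ : Meta) (A C : Fm) :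
      DervB true Θ A → DervB true (Δ.fill [Item.fm A]) C →
      DervB true (Δ.fill Θ) C

/-! ## Bracket-free formulae and the calculi `!L1` and `!wL1` -/

/-- Bracket-free formulae (language of `!L1` / `!wL1`). -/
inductive Fm0 : Type
  | var : ℕ → Fm0
  | one : Fm0
  | ldiv : Fm0 → Fm0 → Fm0
  | rdiv : Fm0 → Fm0 → Fm0
  | mul : Fm0 → Fm0 → Fm0
  | bang : Fm0 → Fm0

/-- Derivability in `!L1` / `!wL1`.  The first boolean allows the weakening
rule (`DervL true` is `!wL1`, `DervL false` is `!L1`); the second boolean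
allows the rule (cut). -/
inductive DervL : Bool → Bool → List Fm0 → Fm0 → Prop
  | id (w cf : Bool) (A : Fm0) : DervL w cf [A] A
  | one_r (w cf : Bool) : DervL w cf [] Fm0.one
  | rdiv_l (w cf : Bool) (Γ Δ₁ Δ₂ : List Fm0) (B C D : Fm0) :
      DervL w cf Γ B → DervL w cf (Δ₁ ++ C :: Δ₂) D →
      DervL w cf (Δ₁ ++ Fm0.rdiv C B :: (Γ ++ Δ₂)) D
  | rdiv_r (w cf : Bool) (Γ : List Fm0) (B C : Fm0) :
      DervL w cf (Γ ++ [B]) C → DervL w cf Γ (Fm0.rdiv C B)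
  | ldiv_l (w cf : Bool) (Γ Δ₁ Δ₂ : List Fm0) (A C D : Fm0) :
      DervL w cf Γ A → DervL w cf (Δ₁ ++ C :: Δ₂) D →
      DervL w cf (Δ₁ ++ Γ ++ Fm0.ldiv A C :: Δ₂) D
  | ldiv_r (w cf : Bool) (Γ : List Fm0) (A C : Fm0) :
      DervL w cf (A :: Γ) C → DervL w cf Γ (Fm0.ldiv A C)
  | mul_l (w cf : Bool) (Δ₁ Δ₂ : List Fm0) (A B D : Fm0) :
      DervL w cf (Δ₁ ++ A :: B :: Δ₂) D → DervL w cf (Δ₁ ++ Fm0.mul A B :: Δ₂) D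
  | mul_r (w cf : Bool) (Γ₁ Γ₂ : List Fm0) (A B : Fm0) :
      DervL w cf Γ₁ A → DervL w cf Γ₂ B → DervL w cf (Γ₁ ++ Γ₂) (Fm0.mul A B)
  | one_l (w cf : Bool) (Δ₁ Δ₂ : List Fm0) (A : Fm0) :
      DervL w cf (Δ₁ ++ Δ₂) A → DervL w cf (Δ₁ ++ Fm0.one :: Δ₂) A
  | bang_l (w cf : Bool) (Δ₁ Δ₂ : List Fm0) (A B : Fm0) :
      DervL w cf (Δ₁ ++ A :: Δ₂) B → DervL w cf (Δ₁ ++ Fm0.bang A :: Δ₂) B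
  | bang_r (w cf : Bool) (Φ : List Fm0) (A : Fm0) :
      DervL w cf (Φ.map Fm0.bang) A → DervL w cf (Φ.map Fm0.bang) (Fm0.bang A)
  | perm1 (w cf : Bool) (Δ₁ Γ Δ₂ : List Fm0) (A B : Fm0) :
      DervL w cf (Δ₁ ++ Fm0.bang A :: (Γ ++ Δ₂)) B →
      DervL w cf (Δ₁ ++ Γ ++ Fm0.bang A :: Δ₂) B
  | perm2 (w cf : Bool) (Δ₁ Γ Δ₂ : List Fm0) (A B : Fm0) :
      DervL w cf (Δ₁ ++ Γ ++ Fm0.bang A :: Δ₂) B →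
      DervL w cf (Δ₁ ++ Fm0.bang A :: (Γ ++ Δ₂)) B
  | contr (w cf : Bool) (Δ₁ Δ₂ : List Fm0) (A B : Fm0) :
      DervL w cf (Δ₁ ++ Fm0.bang A :: Fm0.bang A :: Δ₂) B →
      DervL w cf (Δ₁ ++ Fm0.bang A :: Δ₂) B
  | weak (cf : Bool) (Δ₁ Δ₂ : List Fm0) (A B : Fm0) :
      DervL true cf (Δ₁ ++ Δ₂) B → DervL true cf (Δ₁ ++ Fm0.bang A :: Δ₂) B
  | cut (w : Bool) (Θ Δ₁ Δ₂ : List Fm0) (A C : Fm0) :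
      DervL w true Θ A → DervL w true (Δ₁ ++ A :: Δ₂) C →
      DervL w true (Δ₁ ++ Θ ++ Δ₂) C

/-! ## The Lambek calculus with unit `L1` and theories `L1 + T` -/

/-- Formulae of `L1` (no `!`, no bracket modalities). -/
inductive Fm1 : Type
  | var : ℕ → Fm1
  | one : Fm1
  | ldiv : Fm1 → Fm1 → Fm1
  | rdiv : Fm1 → Fm1 → Fm1
  | mul : Fm1 → Fm1 → Fm1

/-- Sequents of `L1`. -/
abbrev Seq1 := List Fm1 × Fm1

/-- Derivability in `L1 + T` (sequents of `T` are extra axioms). -/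
inductive DervT (T : Set Seq1) : List Fm1 → Fm1 → Prop
  | id (A : Fm1) : DervT T [A] A
  | one_r : DervT T [] Fm1.one
  | ax (Γ : List Fm1) (A : Fm1) : (Γ, A) ∈ T → DervT T Γ A
  | rdiv_l (Γ Δ₁ Δ₂ : List Fm1) (B C D : Fm1) :
      DervT T Γ B → DervT T (Δ₁ ++ C :: Δ₂) D →
      DervT T (Δ₁ ++ Fm1.rdiv C B :: (Γ ++ Δ₂)) D
  | rdiv_r (Γ : List Fm1) (B C : Fm1) :
      DervT T (Γ ++ [B]) C → DervT T Γ (Fm1.rdiv C B)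
  | ldiv_l (Γ Δ₁ Δ₂ : List Fm1) (A C D : Fm1) :
      DervT T Γ A → DervT T (Δ₁ ++ C :: Δ₂) D →
      DervT T (Δ₁ ++ Γ ++ Fm1.ldiv A C :: Δ₂) D
  | ldiv_r (Γ : List Fm1) (A C : Fm1) :
      DervT T (A :: Γ) C → DervT T Γ (Fm1.ldiv A C)
  | mul_l (Δ₁ Δ₂ : List Fm1) (A B D : Fm1) :
      DervT T (Δ₁ ++ A :: B :: Δ₂) D → DervT T (Δ₁ ++ Fm1.mul A B :: Δ₂) D
  | mul_r (Γ₁ Γ₂ : List Fm1) (A B : Fm1) :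
      DervT T Γ₁ A → DervT T Γ₂ B → DervT T (Γ₁ ++ Γ₂) (Fm1.mul A B)
  | one_l (Δ₁ Δ₂ : List Fm1) (A : Fm1) :
      DervT T (Δ₁ ++ Δ₂) A → DervT T (Δ₁ ++ Fm1.one :: Δ₂) A
  | cut (Θ Δ₁ Δ₂ : List Fm1) (A C : Fm1) :
      DervT T Θ A → DervT T (Δ₁ ++ A :: Δ₂) C →
      DervT T (Δ₁ ++ Θ ++ Δ₂) C

/-- Derivability in `L1 + T` where every application of (cut) must have a
sequent from `T` as one of its premises. -/
inductive DervTr (T : Set Seq1) : List Fm1 → Fm1 → Prop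
  | id (A : Fm1) : DervTr T [A] A
  | one_r : DervTr T [] Fm1.one
  | ax (Γ : List Fm1) (A : Fm1) : (Γ, A) ∈ T → DervTr T Γ A
  | rdiv_l (Γ Δ₁ Δ₂ : List Fm1) (B C D : Fm1) :
      DervTr T Γ B → DervTr T (Δ₁ ++ C :: Δ₂) D →
      DervTr T (Δ₁ ++ Fm1.rdiv C B :: (Γ ++ Δ₂)) D
  | rdiv_r (Γ : List Fm1) (B C : Fm1) :
      DervTr T (Γ ++ [B]) C → DervTr T Γ (Fm1.rdiv C B)
  | ldiv_l (Γ Δ₁ Δ₂ : List Fm1) (A C D : Fm1) :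
      DervTr T Γ A → DervTr T (Δ₁ ++ C :: Δ₂) D →
      DervTr T (Δ₁ ++ Γ ++ Fm1.ldiv A C :: Δ₂) D
  | ldiv_r (Γ : List Fm1) (A C : Fm1) :
      DervTr T (A :: Γ) C → DervTr T Γ (Fm1.ldiv A C)
  | mul_l (Δ₁ Δ₂ : List Fm1) (A B D : Fm1) :
      DervTr T (Δ₁ ++ A :: B :: Δ₂) D → DervTr T (Δ₁ ++ Fm1.mul A B :: Δ₂) D
  | mul_r (Γ₁ Γ₂ : List Fm1) (A B : Fm1) :
      DervTr T Γ₁ A → DervTr T Γ₂ B → DervTr T (Γ₁ ++ Γ₂) (Fm1.mul A B)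
  | one_l (Δ₁ Δ₂ : List Fm1) (A : Fm1) :
      DervTr T (Δ₁ ++ Δ₂) A → DervTr T (Δ₁ ++ Fm1.one :: Δ₂) A
  | cut (Θ Δ₁ Δ₂ : List Fm1) (A C : Fm1) :
      (Θ, A) ∈ T ∨ (Δ₁ ++ A :: Δ₂, C) ∈ T →
      DervTr T Θ A → DervTr T (Δ₁ ++ A :: Δ₂) C →
      DervTr T (Δ₁ ++ Θ ++ Δ₂) C

/-- Derivability in `L1 + T` by a derivation all of whose sequents satisfy
the predicate `Good`. -/
inductive DervTgood (T : Set Seq1) (Good : List Fm1 → Fm1 → Prop) : List Fm1 → Fm1 → Prop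
  | id (A : Fm1) : Good [A] A → DervTgood T Good [A] A
  | one_r : Good [] Fm1.one → DervTgood T Good [] Fm1.one
  | ax (Γ : List Fm1) (A : Fm1) : (Γ, A) ∈ T → Good Γ A → DervTgood T Good Γ A
  | rdiv_l (Γ Δ₁ Δ₂ : List Fm1) (B C D : Fm1) :
      DervTgood T Good Γ B → DervTgood T Good (Δ₁ ++ C :: Δ₂) D →
      Good (Δ₁ ++ Fm1.rdiv C B :: (Γ ++ Δ₂)) D →
      DervTgood T Good (Δ₁ ++ Fm1.rdiv C B :: (Γ ++ Δ₂)) D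
  | rdiv_r (Γ : List Fm1) (B C : Fm1) :
      DervTgood T Good (Γ ++ [B]) C → Good Γ (Fm1.rdiv C B) →
      DervTgood T Good Γ (Fm1.rdiv C B)
  | ldiv_l (Γ Δ₁ Δ₂ : List Fm1) (A C D : Fm1) :
      DervTgood T Good Γ A → DervTgood T Good (Δ₁ ++ C :: Δ₂) D →
      Good (Δ₁ ++ Γ ++ Fm1.ldiv A C :: Δ₂) D →
      DervTgood T Good (Δ₁ ++ Γ ++ Fm1.ldiv A C :: Δ₂) D
  | ldiv_r (Γ : List Fm1) (A C : Fm1) :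
      DervTgood T Good (A :: Γ) C → Good Γ (Fm1.ldiv A C) →
      DervTgood T Good Γ (Fm1.ldiv A C)
  | mul_l (Δ₁ Δ₂ : List Fm1) (A B D : Fm1) :
      DervTgood T Good (Δ₁ ++ A :: B :: Δ₂) D →
      Good (Δ₁ ++ Fm1.mul A B :: Δ₂) D →
      DervTgood T Good (Δ₁ ++ Fm1.mul A B :: Δ₂) D
  | mul_r (Γ₁ Γ₂ : List Fm1) (A B : Fm1) :
      DervTgood T Good Γ₁ A → DervTgood T Good Γ₂ B →
      Good (Γ₁ ++ Γ₂) (Fm1.mul A B) →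
      DervTgood T Good (Γ₁ ++ Γ₂) (Fm1.mul A B)
  | one_l (Δ₁ Δ₂ : List Fm1) (A : Fm1) :
      DervTgood T Good (Δ₁ ++ Δ₂) A → Good (Δ₁ ++ Fm1.one :: Δ₂) A →
      DervTgood T Good (Δ₁ ++ Fm1.one :: Δ₂) A
  | cut (Θ Δ₁ Δ₂ : List Fm1) (A C : Fm1) :
      DervTgood T Good Θ A → DervTgood T Good (Δ₁ ++ A :: Δ₂) C →
      Good (Δ₁ ++ Θ ++ Δ₂) C →
      DervTgood T Good (Δ₁ ++ Θ ++ Δ₂) C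

/-- The formula is built from primitive types using only the product `·`. -/
def ProdOnly : Fm1 → Prop
  | Fm1.var _ => True
  | Fm1.mul A B => ProdOnly A ∧ ProdOnly B
  | _ => False

/-- A sequent contains no occurrences of `\`, `/`, `1`. -/
def ProdOnlySeq (Γ : List Fm1) (A : Fm1) : Prop :=
  (∀ F ∈ Γ, ProdOnly F) ∧ ProdOnly A

/-! ## The bracket-forgetting projection -/

/-- BFP on formulae: delete all `⟨⟩` and `[]⁻¹`. -/
def fmBFP : Fm → Fm0
  | Fm.var n => Fm0.var n
  | Fm.one => Fm0.one
  | Fm.ldiv A B => Fm0.ldiv (fmBFP A) (fmBFP B)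
  | Fm.rdiv A B => Fm0.rdiv (fmBFP A) (fmBFP B)
  | Fm.mul A B => Fm0.mul (fmBFP A) (fmBFP B)
  | Fm.dia A => fmBFP A
  | Fm.binv A => fmBFP A
  | Fm.bang A => Fm0.bang (fmBFP A)

mutual
  /-- BFP on items. -/
  def itemBFP : Item → List Fm0
    | Item.fm A => [fmBFP A]
    | Item.br Γ => metaBFP Γ
  /-- BFP on meta-formulae: delete all brackets. -/
  def metaBFP : List Item → List Fm0
    | [] => []
    | i :: Γ => itemBFP i ++ metaBFP Γ
end

/-! ## Generative grammars (semi-Thue systems) -/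

/-- A generative grammar (semi-Thue system) over symbols coded by `ℕ`. -/
structure Grammar where
  nonterminals : Finset ℕ
  terminals : Finset ℕ
  disj : Disjoint nonterminals terminals
  start : ℕ
  start_mem : start ∈ nonterminals
  prods : Finset (List ℕ × List ℕ)
  prods_wf : ∀ p ∈ prods,
    (∀ c ∈ p.1, c ∈ nonterminals ∪ terminals) ∧
    (∀ c ∈ p.2, c ∈ nonterminals ∪ terminals)

/-- One rewriting step `η α θ ⇒_G η β θ`. -/
def Grammar.Step (G : Grammar) (x y : List ℕ) : Prop :=
  ∃ p ∈ G.prods, ∃ η θ : List ℕ, x = η ++ p.1 ++ θ ∧ y = η ++ p.2 ++ θ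

/-- `⇒*_G`: reflexive-transitive closure of `⇒_G`. -/
def Grammar.Derives (G : Grammar) : List ℕ → List ℕ → Prop :=
  Relation.ReflTransGen G.Step

/-- All productions of `G` have nonempty left- and right-hand sides. -/
def Grammar.NonemptySides (G : Grammar) : Prop :=
  ∀ p ∈ G.prods, p.1 ≠ [] ∧ p.2 ≠ []

/-! ### Encoding grammars into formulae -/

/-- `u₁ · … · u_k` as an `Fm`-formula (`1` for the empty word). -/
def wordFm : List ℕ → Fm
  | [] => Fm.one
  | [a] => Fm.var a
  | a :: b :: rest => Fm.mul (Fm.var a) (wordFm (b :: rest))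

/-- `u₁ · … · u_k` as an `Fm0`-formula. -/
def wordFm0 : List ℕ → Fm0
  | [] => Fm0.one
  | [a] => Fm0.var a
  | a :: b :: rest => Fm0.mul (Fm0.var a) (wordFm0 (b :: rest))

/-- `u₁ · … · u_k` as an `Fm1`-formula. -/
def wordFm1 : List ℕ → Fm1
  | [] => Fm1.one
  | [a] => Fm1.var a
  | a :: b :: rest => Fm1.mul (Fm1.var a) (wordFm1 (b :: rest))

/-- The formula `(u₁·…·u_k) / (v₁·…·v_m)` for a production `u ⇒ v`, in `Fm`. -/
def prodFm (p : List ℕ × List ℕ) : Fm := Fm.rdiv (wordFm p.1) (wordFm p.2)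

/-- The formula `(u₁·…·u_k) / (v₁·…·v_m)` for a production `u ⇒ v`, in `Fm0`. -/
def prodFm0 (p : List ℕ × List ℕ) : Fm0 := Fm0.rdiv (wordFm0 p.1) (wordFm0 p.2)

/-- `Γ_G = !B₁, …, !Bₙ` (bracket-free). -/
noncomputable def GammaG (G : Grammar) : List Fm0 :=
  G.prods.toList.map (fun p => Fm0.bang (prodFm0 p))

/-- `Φ_G = !(1 / !B₁), …, !(1 / !Bₙ)` (bracket-free). -/
noncomputable def PhiG (G : Grammar) : List Fm0 :=
  G.prods.toList.map (fun p => Fm0.bang (Fm0.rdiv Fm0.one (Fm0.bang (prodFm0 p))))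

/-- `Γ̃_G = ![]⁻¹B₁, …, ![]⁻¹Bₙ`. -/
noncomputable def GammaTG (G : Grammar) : Meta :=
  G.prods.toList.map (fun p => Item.fm (Fm.bang (Fm.binv (prodFm p))))

/-- `Φ̃_G = !(1 / ![]⁻¹B₁), …, !(1 / ![]⁻¹Bₙ)`. -/
noncomputable def PhiTG (G : Grammar) : Meta :=
  G.prods.toList.map
    (fun p => Item.fm (Fm.bang (Fm.rdiv Fm.one (Fm.bang (Fm.binv (prodFm p))))))

/-- The theory `T_G = { v₁, …, v_m → u₁·…·u_k : (u ⇒ v) ∈ P }`. -/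
def TG (G : Grammar) : Set Seq1 :=
  { q | ∃ p ∈ G.prods, q = (p.2.map Fm1.var, wordFm1 p.1) }

/-! ## Effective encodings of sequents into `ℕ` -/

/-- An effective injective code of `!bL1`-formulae. -/
def encFm : Fm → ℕ
  | Fm.var n => Nat.pair 0 n
  | Fm.one => Nat.pair 1 0
  | Fm.ldiv A B => Nat.pair 2 (Nat.pair (encFm A) (encFm B))
  | Fm.rdiv A B => Nat.pair 3 (Nat.pair (encFm A) (encFm B))
  | Fm.mul A B => Nat.pair 4 (Nat.pair (encFm A) (encFm B))
  | Fm.dia A => Nat.pair 5 (encFm A)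
  | Fm.binv A => Nat.pair 6 (encFm A)
  | Fm.bang A => Nat.pair 7 (encFm A)

mutual
  /-- An effective injective code of items. -/
  def encItem : Item → ℕ
    | Item.fm A => Nat.pair 0 (encFm A)
    | Item.br Γ => Nat.pair 1 (encMeta Γ)
  /-- An effective injective code of meta-formulae. -/
  def encMeta : List Item → ℕ
    | [] => 0
    | i :: Γ => Nat.pair (encItem i) (encMeta Γ) + 1
end

/-- An effective injective code of `!bL1`-sequents. -/
def encSeqB (Γ : Meta) (A : Fm) : ℕ := Nat.pair (encMeta Γ) (encFm A)

/-- An effective injective code of bracket-free formulae. -/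
def encFm0 : Fm0 → ℕ
  | Fm0.var n => Nat.pair 0 n
  | Fm0.one => Nat.pair 1 0
  | Fm0.ldiv A B => Nat.pair 2 (Nat.pair (encFm0 A) (encFm0 B))
  | Fm0.rdiv A B => Nat.pair 3 (Nat.pair (encFm0 A) (encFm0 B))
  | Fm0.mul A B => Nat.pair 4 (Nat.pair (encFm0 A) (encFm0 B))
  | Fm0.bang A => Nat.pair 5 (encFm0 A)

/-- An effective injective code of `!L1`/`!wL1`-sequents. -/
def encSeq0 (Γ : List Fm0) (A : Fm0) : ℕ :=
  Nat.pair ((Γ.map encFm0).foldr (fun a r => Nat.pair a r + 1) 0) (encFm0 A)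

/-! ## Sizes -/

/-- Size (number of symbols) of a formula. -/
def fmSize : Fm → ℕ
  | Fm.var _ => 1
  | Fm.one => 1
  | Fm.ldiv A B => fmSize A + fmSize B + 1
  | Fm.rdiv A B => fmSize A + fmSize B + 1
  | Fm.mul A B => fmSize A + fmSize B + 1
  | Fm.dia A => fmSize A + 1
  | Fm.binv A => fmSize A + 1
  | Fm.bang A => fmSize A + 1

mutual
  /-- Size of an item. -/
  def itemSize : Item → ℕ
    | Item.fm A => fmSize A
    | Item.br Γ => metaSize Γ + 1
  /-- Size of a meta-formula. -/
  def metaSize : List Item → ℕ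
    | [] => 0
    | i :: Γ => itemSize i + metaSize Γ
end

/-! ## Polarity and the bracket non-negative condition -/

/-- `cleanFm pol A`: the formula `A`, all of whose subformula occurrences have
their polarity in the sequent tracked starting from `pol` (`true` = positive),
contains no `[]⁻¹`-subformula at positive polarity and no `⟨⟩`-subformula at
negative polarity. -/
def cleanFm : Bool → Fm → Prop
  | _, Fm.var _ => True
  | _, Fm.one => True
  | pol, Fm.ldiv A B => cleanFm (!pol) A ∧ cleanFm pol B
  | pol, Fm.rdiv B A => cleanFm pol B ∧ cleanFm (!pol) A
  | pol, Fm.mul A B => cleanFm pol A ∧ cleanFm pol B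
  | pol, Fm.dia A => pol = true ∧ cleanFm pol A
  | pol, Fm.binv A => pol = false ∧ cleanFm pol A
  | pol, Fm.bang A => cleanFm pol A

/-- `bnnFm pol A`: every negative occurrence of a `!`-subformula of `A`
(where `A` itself occurs at polarity `pol` in the sequent) includes no
positive occurrence of `[]⁻¹C` and no negative occurrence of `⟨⟩C`. -/
def bnnFm : Bool → Fm → Prop
  | _, Fm.var _ => True
  | _, Fm.one => True
  | pol, Fm.ldiv A B => bnnFm (!pol) A ∧ bnnFm pol B
  | pol, Fm.rdiv B A => bnnFm pol B ∧ bnnFm (!pol) A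
  | pol, Fm.mul A B => bnnFm pol A ∧ bnnFm pol B
  | pol, Fm.dia A => bnnFm pol A
  | pol, Fm.binv A => bnnFm pol A
  | pol, Fm.bang A => (pol = false → cleanFm false A) ∧ bnnFm pol A

mutual
  /-- The bracket non-negative condition for an item of an antecedent. -/
  def bnnItem : Item → Prop
    | Item.fm A => bnnFm false A
    | Item.br Γ => bnnMeta Γ
  /-- The bracket non-negative condition for an antecedent. -/
  def bnnMeta : List Item → Prop
    | [] => True
    | i :: Γ => bnnItem i ∧ bnnMeta Γ
end

/-- The sequent `Γ → C` obeys the bracket non-negative condition. -/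
def bnnSeq (Γ : Meta) (C : Fm) : Prop := bnnMeta Γ ∧ bnnFm true C

/-! ## The formulation of `!bL1` with the generalized permutation rule -/

/-- `interleave Δ₀ [(A₁,Δ₁), …, (A_k,Δ_k)] = Δ₀, !A₁, Δ₁, …, !A_k, Δ_k`. -/
def interleave : Meta → List (Fm × Meta) → Meta
  | Δ₀, [] => Δ₀
  | Δ₀, (A, Δ) :: rest => Δ₀ ++ Item.fm (Fm.bang A) :: interleave Δ rest

/-- Derivations in the formulation of `!bL1` in which `(perm₁)`, `(perm₂)` are
replaced by the generalized permutation rule `(perm)*`.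
`NDervP cf b n Γ C` means: there is a derivation of `Γ → C` in which
(cut) is allowed only if `cf = true`, no two applications of `(perm)*` are
consecutive, `b` records whether the last rule applied is `(perm)*`, and the
derivation has exactly `n` rule applications (axiom instances included). -/
inductive NDervP : Bool → Bool → ℕ → Meta → Fm → Prop
  | id (cf : Bool) (A : Fm) : NDervP cf false 1 [Item.fm A] A
  | one_r (cf : Bool) : NDervP cf false 1 [] Fm.one
  | rdiv_l (cf b₁ b₂ : Bool) (n₁ n₂ : ℕ) (Δ : Ctx) (Γ : Meta) (B C D : Fm) :
      NDervP cf b₁ n₁ Γ B → NDervP cf b₂ n₂ (Δ.fill [Item.fm C]) D →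
      NDervP cf false (n₁ + n₂ + 1) (Δ.fill (Item.fm (Fm.rdiv C B) :: Γ)) D
  | rdiv_r (cf b : Bool) (n : ℕ) (Γ : Meta) (B C : Fm) :
      NDervP cf b n (Γ ++ [Item.fm B]) C → NDervP cf false (n + 1) Γ (Fm.rdiv C B)
  | ldiv_l (cf b₁ b₂ : Bool) (n₁ n₂ : ℕ) (Δ : Ctx) (Γ : Meta) (A C D : Fm) :
      NDervP cf b₁ n₁ Γ A → NDervP cf b₂ n₂ (Δ.fill [Item.fm C]) D →
      NDervP cf false (n₁ + n₂ + 1) (Δ.fill (Γ ++ [Item.fm (Fm.ldiv A C)])) D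
  | ldiv_r (cf b : Bool) (n : ℕ) (Γ : Meta) (A C : Fm) :
      NDervP cf b n (Item.fm A :: Γ) C → NDervP cf false (n + 1) Γ (Fm.ldiv A C)
  | mul_l (cf b : Bool) (n : ℕ) (Δ : Ctx) (A B D : Fm) :
      NDervP cf b n (Δ.fill [Item.fm A, Item.fm B]) D →
      NDervP cf false (n + 1) (Δ.fill [Item.fm (Fm.mul A B)]) D
  | mul_r (cf b₁ b₂ : Bool) (n₁ n₂ : ℕ) (Γ₁ Γ₂ : Meta) (A B : Fm) :
      NDervP cf b₁ n₁ Γ₁ A → NDervP cf b₂ n₂ Γ₂ B →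
      NDervP cf false (n₁ + n₂ + 1) (Γ₁ ++ Γ₂) (Fm.mul A B)
  | one_l (cf b : Bool) (n : ℕ) (Δ : Ctx) (A : Fm) :
      NDervP cf b n (Δ.fill []) A → NDervP cf false (n + 1) (Δ.fill [Item.fm Fm.one]) A
  | dia_l (cf b : Bool) (n : ℕ) (Δ : Ctx) (A C : Fm) :
      NDervP cf b n (Δ.fill [Item.br [Item.fm A]]) C →
      NDervP cf false (n + 1) (Δ.fill [Item.fm (Fm.dia A)]) C
  | dia_r (cf b : Bool) (n : ℕ) (Θ : Meta) (A : Fm) :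
      NDervP cf b n Θ A → NDervP cf false (n + 1) [Item.br Θ] (Fm.dia A)
  | binv_l (cf b : Bool) (n : ℕ) (Δ : Ctx) (A C : Fm) :
      NDervP cf b n (Δ.fill [Item.fm A]) C →
      NDervP cf false (n + 1) (Δ.fill [Item.br [Item.fm (Fm.binv A)]]) C
  | binv_r (cf b : Bool) (n : ℕ) (Θ : Meta) (A : Fm) :
      NDervP cf b n [Item.br Θ] A → NDervP cf false (n + 1) Θ (Fm.binv A)
  | bang_l (cf b : Bool) (n : ℕ) (Δ : Ctx) (A B : Fm) :
      NDervP cf b n (Δ.fill [Item.fm A]) B →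
      NDervP cf false (n + 1) (Δ.fill [Item.fm (Fm.bang A)]) B
  | bang_r (cf b : Bool) (n : ℕ) (Φ : List Fm) (A : Fm) :
      NDervP cf b n (bangs Φ) A → NDervP cf false (n + 1) (bangs Φ) (Fm.bang A)
  | contr (cf b : Bool) (n : ℕ) (Δ : Ctx) (Φ : List Fm) (Γ : Meta) (B : Fm) :
      Φ ≠ [] →
      NDervP cf b n (Δ.fill (bangs Φ ++ [Item.br (bangs Φ ++ Γ)])) B →
      NDervP cf false (n + 1) (Δ.fill (bangs Φ ++ Γ)) B
  | permStar (cf : Bool) (n : ℕ) (Δ : Ctx) (Δ₀ : Meta) (L L' : List (Fm × Meta)) (C : Fm) :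
      L.map Prod.snd = L'.map Prod.snd →
      (L.map Prod.fst).Perm (L'.map Prod.fst) →
      NDervP cf false n (Δ.fill (interleave Δ₀ L)) C →
      NDervP cf true (n + 1) (Δ.fill (interleave Δ₀ L')) C
  | cut (b₁ b₂ : Bool) (n₁ n₂ : ℕ) (Δ : Ctx) (Θ : Meta) (A C : Fm) :
      NDervP true b₁ n₁ Θ A → NDervP true b₂ n₂ (Δ.fill [Item.fm A]) C →
      NDervP true false (n₁ + n₂ + 1) (Δ.fill Θ) C

/-- Every derivation in `!L1` is a derivation in `!wL1`. -/
theorem DervL.to_weak {w cf : Bool} {Γ : List Fm0} {A : Fm0} (h : DervL w cf Γ A) :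
    DervL true cf Γ A := by
  induction h with
  | id => exact .id ..
  | one_r => exact .one_r ..
  | rdiv_l _ _ _ _ _ _ _ _ _ _ ih₁ ih₂ => exact .rdiv_l _ _ _ _ _ _ _ _ ih₁ ih₂
  | rdiv_r _ _ _ _ _ _ ih => exact .rdiv_r _ _ _ _ _ ih
  | ldiv_l _ _ _ _ _ _ _ _ _ _ ih₁ ih₂ => exact .ldiv_l _ _ _ _ _ _ _ _ ih₁ ih₂
  | ldiv_r _ _ _ _ _ _ ih => exact .ldiv_r _ _ _ _ _ ih
  | mul_l _ _ _ _ _ _ _ _ ih => exact .mul_l _ _ _ _ _ _ _ ih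
  | mul_r _ _ _ _ _ _ _ _ ih₁ ih₂ => exact .mul_r _ _ _ _ _ _ ih₁ ih₂
  | one_l _ _ _ _ _ _ ih => exact .one_l _ _ _ _ _ ih
  | bang_l _ _ _ _ _ _ _ ih => exact .bang_l _ _ _ _ _ _ ih
  | bang_r _ _ _ _ _ ih => exact .bang_r _ _ _ _ ih
  | perm1 _ _ _ _ _ _ _ _ ih => exact .perm1 _ _ _ _ _ _ _ ih
  | perm2 _ _ _ _ _ _ _ _ ih => exact .perm2 _ _ _ _ _ _ _ ih
  | contr _ _ _ _ _ _ _ ih => exact .contr _ _ _ _ _ _ ih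
  | weak _ _ _ _ _ _ ih => exact .weak _ _ _ _ _ ih
  | cut _ _ _ _ _ _ _ _ ih₁ ih₂ => exact .cut _ _ _ _ _ _ ih₁ ih₂

/-- `Λ → !(1 / !B)` is derivable in `!wL1`. -/
theorem dervL_bang_one_rdiv_bang (cf : Bool) (B : Fm0) :
    DervL true cf [] (.bang (.rdiv .one (.bang B))) :=
  .bang_r true cf [] _ (.rdiv_r _ _ _ _ _ (.weak cf [] [] B _ (.one_r _ _)))

/-- Formulae derivable from the empty antecedent can be cut from the front of an antecedent. -/
theorem DervL.of_append_left {w : Bool} {Φ Γ : List Fm0} {A : Fm0}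
    (hΦ : ∀ F ∈ Φ, DervL w true [] F) (h : DervL w true (Φ ++ Γ) A) : DervL w true Γ A := by
  induction Φ with
  | nil => exact h
  | cons F Φ ih =>
    exact ih (fun F' hF' => hΦ F' (List.mem_cons_of_mem _ hF'))
      (.cut w [] [] (Φ ++ Γ) F A (hΦ F List.mem_cons_self) h)

/-- If `Φ_G, Γ_G, a₁, …, aₙ → s` is derivable in `!L1`,
then `Γ_G, a₁, …, aₙ → s` is derivable in `!wL1`. -/
theorem bangL_to_wL (G : Grammar) (hne : G.NonemptySides)
    (as : List ℕ) (has : ∀ a ∈ as, a ∈ G.terminals)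
    (h : DervL false true (PhiG G ++ GammaG G ++ as.map Fm0.var) (Fm0.var G.start)) :
    DervL true true (GammaG G ++ as.map Fm0.var) (Fm0.var G.start) := by
  rw [List.append_assoc] at h
  refine DervL.of_append_left (fun F hF => ?_) h.to_weak
  obtain ⟨p, -, rfl⟩ := List.mem_map.mp hF
  exact dervL_bang_one_rdiv_bang _ _

end Lambek
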